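/- arXiv:0802.1005 — 2 statements merged into one kernel-verified Lean document; each statement's English description precedes it below -/
import Mathlib

section
/- Let g, f, n be natural numbers with g ≥ 2, 1 ≤ f ≤ 4g − 4, and n = ⌈(3 + Real.sqrt (9 + 8·((2g + f : ℝ) − 2)))/2⌉. Then, as real numbers, (n² − 5n + 14)/12 ≤ g ≤ (n − 1)(n − 2)/4. -/
/-- From the proof of Proposition 4: with `g ≥ 2`, `1 ≤ f ≤ 4g − 4` and
`n = ⌈(3 + √(9 + 8(2g + f − 2)))/2⌉`, one has
`(n² − 5n + 14)/12 ≤ g ≤ (n − 1)(n − 2)/4` as real numbers. -/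
theorem stmt_1 (g f n : ℕ) (hg : 2 ≤ g) (hf1 : 1 ≤ f) (hf2 : f ≤ 4 * g - 4)
    (hn : n = ⌈(3 + Real.sqrt (9 + 8 * ((2 * g + f : ℝ) - 2))) / 2⌉₊) :
    ((n : ℝ) ^ 2 - 5 * n + 14) / 12 ≤ (g : ℝ) ∧
      (g : ℝ) ≤ ((n : ℝ) - 1) * ((n : ℝ) - 2) / 4 := by
  have hg' : (2 : ℝ) ≤ g := by exact_mod_cast hg
  have hf1' : (1 : ℝ) ≤ f := by exact_mod_cast hf1
  have hf2' : (f : ℝ) + 4 ≤ 4 * g := by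
    have : f + 4 ≤ 4 * g := by lia
    exact_mod_cast this
  set s := Real.sqrt (9 + 8 * ((2 * g + f : ℝ) - 2))
  have hsq : s ^ 2 = 9 + 8 * ((2 * g + f : ℝ) - 2) := Real.sq_sqrt (by linarith)
  have hs3 : 3 ≤ s := Real.le_sqrt_of_sq_le (by linarith)
  have hle : (3 + s) / 2 ≤ (n : ℝ) := hn ▸ Nat.le_ceil _
  have hlt : (n : ℝ) < (3 + s) / 2 + 1 := hn ▸ Nat.ceil_lt_add_one (by linarith)
  have hlower : s ^ 2 ≤ (2 * (n : ℝ) - 3) ^ 2 :=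
    pow_le_pow_left₀ (by linarith) (by linarith) 2
  have hupper : (2 * (n : ℝ) - 5) ^ 2 ≤ s ^ 2 :=
    pow_le_pow_left₀ (by linarith) (by linarith) 2
  constructor <;> linarith
end

section
/- Let g, f, n be natural numbers with g ≥ 2, 1 ≤ f ≤ 4g − 4, and n = ⌈(3 + Real.sqrt (9 + 8·((2g + f : ℝ) − 2)))/2⌉. Then ⌈((n − 3)(n − 4) : ℝ)/12⌉ ≤ g ≤ ⌈((n − 1)(n − 2) : ℝ)/4⌉. -/
/-- From the proof of Proposition 4: with `g ≥ 2`, `1 ≤ f ≤ 4g − 4` and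
`n = ⌈(3 + √(9 + 8(2g + f − 2)))/2⌉`, one has
`⌈(n−3)(n−4)/12⌉ ≤ g ≤ ⌈(n−1)(n−2)/4⌉` (genus and maximal genus of `K_n`). -/
theorem stmt_2 (g f n : ℕ) (hg : 2 ≤ g) (hf1 : 1 ≤ f) (hf2 : f ≤ 4 * g - 4)
    (hn : n = ⌈(3 + Real.sqrt (9 + 8 * ((2 * g + f : ℝ) - 2))) / 2⌉₊) :
    ⌈(((n : ℝ) - 3) * ((n : ℝ) - 4)) / 12⌉ ≤ (g : ℤ) ∧
      (g : ℤ) ≤ ⌈(((n : ℝ) - 1) * ((n : ℝ) - 2)) / 4⌉ := by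
  have hgR : (2 : ℝ) ≤ g := by exact_mod_cast hg
  have hf1R : (1 : ℝ) ≤ f := by exact_mod_cast hf1
  have hf2R : (f : ℝ) + 4 ≤ 4 * g := by
    have h : f + 4 ≤ 4 * g := by omega
    exact_mod_cast h
  set s := Real.sqrt (9 + 8 * ((2 * g + f : ℝ) - 2))
  have hsq : s ^ 2 = 9 + 8 * ((2 * g + f : ℝ) - 2) := Real.sq_sqrt (by linarith)
  have hs3 : 3 ≤ s := Real.le_sqrt_of_sq_le (by linarith)
  have hle : (3 + s) / 2 ≤ (n : ℝ) := hn ▸ Nat.le_ceil _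
  have hlt : (n : ℝ) < (3 + s) / 2 + 1 := hn ▸ Nat.ceil_lt_add_one (by linarith)
  have hlower : s ^ 2 ≤ (2 * (n : ℝ) - 3) ^ 2 :=
    pow_le_pow_left₀ (by linarith) (by linarith) 2
  have hupper : (2 * (n : ℝ) - 5) ^ 2 ≤ s ^ 2 :=
    pow_le_pow_left₀ (by linarith) (by linarith) 2
  constructor
  · rw [Int.ceil_le, Int.cast_natCast]
    linarith
  · have h : (g : ℝ) ≤ ((n : ℝ) - 1) * ((n : ℝ) - 2) / 4 := by linarith
    exact_mod_cast h.trans (Int.le_ceil _)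
end
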